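/- There is an absolute constant c > 0 such that for every integer k ≥ 3 the following holds: for all nonempty finite sets P_1, P_2, …, P_k of points in the plane whose union is in general position, there exist subsets P_1' ⊆ P_1, P_2' ⊆ P_2, …, P_k' ⊆ P_k with |P_i'| ≥ 2^{−c·k·log k}·|P_i| for all i, such that (P_1', …, P_k') has same-type transversals. -/

import Mathlib

/-- The orientation (±1, or 0 for degenerate triples) of an ordered triple of points in the
plane. -/
noncomputable def orient (p q r : ℝ × ℝ) : ℝ :=
  Real.sign ((q.1 - p.1) * (r.2 - p.2) - (q.2 - p.2) * (r.1 - p.1))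

/-- A set of points in the plane is in general position if no three of its points are
collinear. -/
def InGeneralPosition (S : Set (ℝ × ℝ)) : Prop :=
  ∀ p ∈ S, ∀ q ∈ S, ∀ r ∈ S, p ≠ q → p ≠ r → q ≠ r →
    ¬ Collinear ℝ ({p, q, r} : Set (ℝ × ℝ))

/-- `(P 0, …, P (k−1))` has same-type transversals: any two transversals have the same order
type, i.e. every triple of indices receives the same orientation in all transversals. -/
def SameTypeTransversals {k : ℕ} (P : Fin k → Finset (ℝ × ℝ)) : Prop :=
  ∀ f g : Fin k → ℝ × ℝ, (∀ i, f i ∈ P i) → (∀ i, g i ∈ P i) →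
    ∀ i j l : Fin k, i < j → j < l →
      orient (f i) (f j) (f l) = orient (g i) (g j) (g l)


def NC (g : ℝ × ℝ → ℝ) (Q : Finset (ℝ × ℝ)) : Prop :=
  (∀ q ∈ Q, 0 ≤ g q) ∨ (∀ q ∈ Q, g q ≤ 0)

def IsAff (g : ℝ × ℝ → ℝ) : Prop := ∃ a b c : ℝ, ∀ p, g p = a * p.1 + b * p.2 + c

theorem NC.mono {g : ℝ × ℝ → ℝ} {Q R : Finset (ℝ × ℝ)} (h : NC g R) (hs : Q ⊆ R) : NC g Q := by
  rcases h with h | h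
  · exact Or.inl fun q hq => h q (hs hq)
  · exact Or.inr fun q hq => h q (hs hq)

/-- h-th order statistic, continuous family version. -/
theorem kth_exists (S : Finset (ℝ × ℝ)) (h : ℕ) (h1 : 1 ≤ h) (h2 : h ≤ S.card) :
    ∃ M : ((ℝ × ℝ) → ℝ) → ℝ,
      (∀ u : ℝ → (ℝ × ℝ) → ℝ, (∀ p, Continuous fun t => u t p) → Continuous fun t => M (u t)) ∧
      (∀ φ, ∃ p ∈ S, M φ = φ p) ∧
      (∀ φ, ∃ T ⊆ S, T.card = h ∧ (∀ p ∈ T, φ p ≤ M φ) ∧ ∀ p ∈ S \ T, M φ ≤ φ p) := by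
  classical
  have hne : (S.powersetCard h).attach.Nonempty := by
    rw [Finset.attach_nonempty_iff]
    exact Finset.powersetCard_nonempty.2 h2
  have hT : ∀ T : {x // x ∈ S.powersetCard h}, T.1.Nonempty := by
    intro T
    have := (Finset.mem_powersetCard.1 T.2).2
    exact Finset.card_pos.1 (by omega)
  refine ⟨fun φ => (S.powersetCard h).attach.inf' hne fun T => T.1.sup' (hT T) φ, ?_, ?_, ?_⟩
  · intro u hu
    apply Continuous.finset_inf'_apply
    intro T _
    apply Continuous.finset_sup'_apply
    intro p _
    exact hu p
  · intro φ
    obtain ⟨T, _, hT'⟩ := Finset.exists_mem_eq_inf' hne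
      (fun T : {x // x ∈ S.powersetCard h} => T.1.sup' (hT T) φ)
    obtain ⟨p, hp, hp'⟩ := Finset.exists_mem_eq_sup' (hT T) φ
    refine ⟨p, (Finset.mem_powersetCard.1 T.2).1 hp, ?_⟩
    simp only at hT' ⊢
    rw [hT', hp']
  · intro φ
    simp only
    set θ := (S.powersetCard h).attach.inf' hne (fun T => T.1.sup' (hT T) φ) with hθ
    have hle : h ≤ (S.filter fun p => φ p ≤ θ).card := by
      obtain ⟨T, _, hT'⟩ := Finset.exists_mem_eq_inf' hne
        (fun T : {x // x ∈ S.powersetCard h} => T.1.sup' (hT T) φ)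
      have h3 := Finset.mem_powersetCard.1 T.2
      rw [← h3.2]
      apply Finset.card_le_card
      intro p hp
      rw [Finset.mem_filter]
      refine ⟨h3.1 hp, ?_⟩
      rw [hθ, hT']
      exact Finset.le_sup' φ hp
    have hlt : (S.filter fun p => φ p < θ).card ≤ h := by
      by_contra hcon
      push Not at hcon
      obtain ⟨T, hTs, hTc⟩ := Finset.exists_subset_card_eq hcon.le
      have hTm : T ∈ S.powersetCard h :=
        Finset.mem_powersetCard.2 ⟨hTs.trans (Finset.filter_subset _ _), hTc⟩
      have h4 : θ ≤ T.sup' (hT ⟨T, hTm⟩) φ := by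
        rw [hθ]
        exact Finset.inf'_le (fun T : {x // x ∈ S.powersetCard h} => T.1.sup' (hT T) φ)
          (Finset.mem_attach _ ⟨T, hTm⟩)
      obtain ⟨p, hp, hp'⟩ := Finset.exists_mem_eq_sup' (hT ⟨T, hTm⟩) φ
      have := (Finset.mem_filter.1 (hTs hp)).2
      simp only at hp' h4
      rw [hp'] at h4
      linarith
    obtain ⟨T, hT1, hT2, hT3⟩ := Finset.exists_subsuperset_card_eq
      (s := S.filter fun p => φ p < θ) (t := S.filter fun p => φ p ≤ θ)
      (by intro p; simp only [Finset.mem_filter]; exact fun h => ⟨h.1, h.2.le⟩) hlt hle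
    refine ⟨T, hT2.trans (Finset.filter_subset _ _), hT3, ?_, ?_⟩
    · intro p hp
      exact (Finset.mem_filter.1 (hT2 hp)).2
    · intro p hp
      rw [Finset.mem_sdiff] at hp
      by_contra hcon
      push Not at hcon
      exact hp.2 (hT1 (Finset.mem_filter.2 ⟨hp.1, hcon⟩))

theorem shear_exists (P : Finset (ℝ × ℝ)) :
    ∃ t : ℝ, ∀ p ∈ P, ∀ q ∈ P, p.1 + t * p.2 = q.1 + t * q.2 → p = q := by
  classical
  obtain ⟨t, ht⟩ := Infinite.exists_notMem_finset
    ((P ×ˢ P).image fun z : (ℝ × ℝ) × (ℝ × ℝ) => -(z.1.1 - z.2.1) / (z.1.2 - z.2.2))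
  refine ⟨t, fun p hp q hq h => ?_⟩
  by_contra hne
  have h2 : p.2 - q.2 ≠ 0 := by
    intro h0
    apply hne
    have h3 : p.2 = q.2 := by linarith
    refine Prod.ext ?_ h3
    rw [h3] at h; linarith
  apply ht
  rw [Finset.mem_image]
  refine ⟨(p, q), Finset.mem_product.2 ⟨hp, hq⟩, ?_⟩
  rw [div_eq_iff h2]
  linarith

theorem quad_split (P : Finset (ℝ × ℝ)) (hP : 4 ≤ P.card) :
    ∃ col : ℝ × ℝ → Bool × Bool,
      (∀ b, P.card ≤ 7 * (P.filter fun y => col y = b).card) ∧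
      ∀ g, IsAff g → ∃ b, NC g (P.filter fun y => col y = b) := by
  classical
  obtain ⟨τ, hτ⟩ := shear_exists P
  set X : ℝ × ℝ → ℝ := fun p => p.1 + τ * p.2 with hX
  obtain ⟨M, _, hM2, hM3⟩ := kth_exists P (P.card / 2) (by omega) (by omega)
  obtain ⟨A, hAP, hAc, hA1, hA2⟩ := hM3 X
  set x0 := M X
  set B := P \ A with hB
  have hBc : B.card = P.card - P.card / 2 := by
    rw [hB, Finset.card_sdiff_of_subset hAP, hAc]
  have hAB : ∀ a ∈ A, ∀ b ∈ B, X a < X b := by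
    intro a ha b hb
    refine lt_of_le_of_ne ((hA1 a ha).trans (hA2 b hb)) fun h => ?_
    have hb' := Finset.mem_sdiff.1 hb
    have := hτ a (hAP ha) b hb'.1 h
    exact hb'.2 (this ▸ ha)
  obtain ⟨MA, hMA1, hMA2, hMA3⟩ := kth_exists A (A.card / 2) (by omega) (by omega)
  obtain ⟨MB, hMB1, hMB2, hMB3⟩ := kth_exists B (B.card / 2) (by omega) (by omega)
  set u : ℝ → ℝ × ℝ → ℝ := fun t p => (1 - t ^ 2) * p.2 - t * X p with hu
  have hcu : ∀ p, Continuous fun t => u t p := by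
    intro p; simp only [hu]; fun_prop
  have hD : Continuous fun t => MA (u t) - MB (u t) := (hMA1 u hcu).sub (hMB1 u hcu)
  have hneg : MA (u (-1)) - MB (u (-1)) < 0 := by
    obtain ⟨a, ha, ha'⟩ := hMA2 (u (-1))
    obtain ⟨b, hb, hb'⟩ := hMB2 (u (-1))
    have := hAB a ha b hb
    rw [ha', hb']; simp only [hu]; linarith
  have hpos : 0 < MA (u 1) - MB (u 1) := by
    obtain ⟨a, ha, ha'⟩ := hMA2 (u 1)
    obtain ⟨b, hb, hb'⟩ := hMB2 (u 1)
    have := hAB a ha b hb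
    rw [ha', hb']; simp only [hu]; linarith
  obtain ⟨t, ht, ht0⟩ := intermediate_value_Ioo (by norm_num : (-1 : ℝ) ≤ 1) hD.continuousOn
    (show (0 : ℝ) ∈ Set.Ioo _ _ from ⟨hneg, hpos⟩)
  simp only at ht0
  have hk : 0 < 1 - t ^ 2 := by nlinarith [ht.1, ht.2]
  obtain ⟨A1, hA1s, hA1c, hA1l, hA1u⟩ := hMA3 (u t)
  obtain ⟨B1, hB1s, hB1c, hB1l, hB1u⟩ := hMB3 (u t)
  have heq : MB (u t) = MA (u t) := by linarith
  rw [heq] at hB1l hB1u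
  set θ := MA (u t)
  have hBP : B ⊆ P := Finset.sdiff_subset
  have hdis : ∀ p, p ∈ A → p ∈ B → False := fun p h1 h2 => (Finset.mem_sdiff.1 h2).2 h1
  have hcov : ∀ p ∈ P, p ∉ A → p ∈ B := fun p h1 h2 => Finset.mem_sdiff.2 ⟨h1, h2⟩
  set col : ℝ × ℝ → Bool × Bool := fun p => (decide (p ∈ A), decide (p ∈ A1 ∪ B1)) with hcol
  have c1 : (P.filter fun y => col y = (true, true)) = A1 := by
    ext p
    simp only [hcol, Finset.mem_filter, Prod.mk.injEq, decide_eq_true_eq, Finset.mem_union]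
    constructor
    · rintro ⟨h1, h2, h3 | h3⟩
      · exact h3
      · exact (hdis p h2 (hB1s h3)).elim
    · intro h; exact ⟨hAP (hA1s h), hA1s h, Or.inl h⟩
  have c2 : (P.filter fun y => col y = (true, false)) = A \ A1 := by
    ext p
    simp only [hcol, Finset.mem_filter, Prod.mk.injEq, decide_eq_true_eq, decide_eq_false_iff_not,
      Finset.mem_union, Finset.mem_sdiff]
    constructor
    · rintro ⟨h1, h2, h3⟩
      exact ⟨h2, fun h => h3 (Or.inl h)⟩
    · rintro ⟨h1, h2⟩
      refine ⟨hAP h1, h1, ?_⟩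
      rintro (h | h)
      · exact h2 h
      · exact hdis p h1 (hB1s h)
  have c3 : (P.filter fun y => col y = (false, true)) = B1 := by
    ext p
    simp only [hcol, Finset.mem_filter, Prod.mk.injEq, decide_eq_true_eq, decide_eq_false_iff_not,
      Finset.mem_union]
    constructor
    · rintro ⟨h1, h2, h3 | h3⟩
      · exact (h2 (hA1s h3)).elim
      · exact h3
    · intro h; exact ⟨hBP (hB1s h), fun h' => hdis p h' (hB1s h), Or.inr h⟩
  have c4 : (P.filter fun y => col y = (false, false)) = B \ B1 := by
    ext p
    simp only [hcol, Finset.mem_filter, Prod.mk.injEq, decide_eq_false_iff_not,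
      Finset.mem_union, Finset.mem_sdiff]
    constructor
    · rintro ⟨h1, h2, h3⟩
      exact ⟨hcov p h1 h2, fun h => h3 (Or.inr h)⟩
    · rintro ⟨h1, h2⟩
      refine ⟨hBP h1, fun h => hdis p h h1, ?_⟩
      rintro (h | h)
      · exact hdis p (hA1s h) h1
      · exact h2 h
  have hs1 := Finset.card_sdiff_of_subset hA1s
  have hs2 := Finset.card_sdiff_of_subset hB1s
  refine ⟨col, ?_, ?_⟩
  · rintro ⟨b1, b2⟩
    cases b1 <;> cases b2
    · rw [c4]; omega
    · rw [c3]; omega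
    · rw [c2]; omega
    · rw [c1]; omega
  · rintro g ⟨a, b, c, hg⟩
    -- coordinates
    set β := b - a * τ with hβ
    set β' := β / (1 - t ^ 2) with hβ'
    set α' := a + β' * t with hα'
    set g0 := c + α' * x0 + β' * θ with hg0
    have hform : ∀ p, g p = g0 + α' * (X p - x0) + β' * (u t p - θ) := by
      intro p
      have e1 : β' * (1 - t ^ 2) = β := by rw [hβ']; field_simp
      rw [hg p, hg0, hα']
      simp only [hu, hX]
      have : β' * ((1 - t ^ 2) * p.2) = (b - a * τ) * p.2 := by
        rw [← mul_assoc, e1]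
      linear_combination (-1) * this
    have x1 : ∀ p ∈ A, X p - x0 ≤ 0 := fun p hp => by linarith [hA1 p hp]
    have x2 : ∀ p ∈ B, 0 ≤ X p - x0 := fun p hp => by linarith [hA2 p hp]
    have key : ∀ g0 α β : ℝ, 0 ≤ g0 → ∃ b, ∀ p ∈ (P.filter fun y => col y = b),
        0 ≤ g0 + α * (X p - x0) + β * (u t p - θ) := by
      intro g0 α β h0
      rcases le_total 0 α with ha | ha <;> rcases le_total 0 β with hb | hb
      · refine ⟨(false, false), ?_⟩
        rw [c4]
        intro p hp
        have := x2 p (Finset.mem_sdiff.1 hp).1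
        have := hB1u p hp
        have := mul_nonneg ha (x2 p (Finset.mem_sdiff.1 hp).1)
        have := mul_nonneg hb (sub_nonneg.2 (hB1u p hp))
        linarith
      · refine ⟨(false, true), ?_⟩
        rw [c3]
        intro p hp
        have := mul_nonneg ha (x2 p (hB1s hp))
        have := mul_nonneg_of_nonpos_of_nonpos hb (sub_nonpos.2 (hB1l p hp))
        linarith
      · refine ⟨(true, false), ?_⟩
        rw [c2]
        intro p hp
        have := mul_nonneg_of_nonpos_of_nonpos ha (x1 p (Finset.mem_sdiff.1 hp).1)
        have := mul_nonneg hb (sub_nonneg.2 (hA1u p hp))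
        linarith
      · refine ⟨(true, true), ?_⟩
        rw [c1]
        intro p hp
        have := mul_nonneg_of_nonpos_of_nonpos ha (x1 p (hA1s hp))
        have := mul_nonneg_of_nonpos_of_nonpos hb (sub_nonpos.2 (hA1l p hp))
        linarith
    rcases le_total 0 g0 with h0 | h0
    · obtain ⟨b, hb⟩ := key g0 α' β' h0
      exact ⟨b, Or.inl fun p hp => by rw [hform]; exact hb p hp⟩
    · obtain ⟨b, hb⟩ := key (-g0) (-α') (-β') (by linarith)
      exact ⟨b, Or.inr fun p hp => by rw [hform]; linarith [hb p hp]⟩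

theorem split_step (P : Finset (ℝ × ℝ)) (hP : P.Nonempty) :
    ∃ (κ : Type) (_ : DecidableEq κ) (col : ℝ × ℝ → κ),
      (∀ x ∈ P, P.card ≤ 7 * (P.filter fun y => col y = col x).card) ∧
      ∀ g, IsAff g → ∃ x ∈ P, NC g (P.filter fun y => col y = col x) := by
  classical
  by_cases h4 : 4 ≤ P.card
  · obtain ⟨col, h1, h2⟩ := quad_split P h4
    refine ⟨Bool × Bool, inferInstance, col, fun x _ => h1 _, fun g hg => ?_⟩
    obtain ⟨b, hb⟩ := h2 g hg
    have hc := h1 b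
    have : (P.filter fun y => col y = b).Nonempty := Finset.card_pos.1 (by omega)
    obtain ⟨x, hx⟩ := this
    rw [Finset.mem_filter] at hx
    exact ⟨x, hx.1, by rw [hx.2]; exact hb⟩
  · have hf : ∀ x ∈ P, (P.filter fun y => y = x) = {x} := by
      intro x hx
      ext y
      simp only [Finset.mem_filter, Finset.mem_singleton]
      exact ⟨fun h => h.2, fun h => ⟨h ▸ hx, h⟩⟩
    refine ⟨ℝ × ℝ, inferInstance, id, ?_, ?_⟩
    · intro x hx
      simp only [id]
      rw [hf x hx, Finset.card_singleton]; omega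
    · intro g _
      obtain ⟨x, hx⟩ := hP
      refine ⟨x, hx, ?_⟩
      simp only [id]
      rw [hf x hx]
      rcases le_total 0 (g x) with h | h
      · left; simpa using h
      · right; simpa using h

open Classical in
theorem class_exists (s : ℕ) : ∀ (P : Finset (ℝ × ℝ)),
    ∃ cl : ℝ × ℝ → Finset (ℝ × ℝ),
      (∀ x ∈ P, x ∈ cl x ∧ cl x ⊆ P ∧ P.card ≤ 7 ^ s * (cl x).card) ∧
      ∀ g, IsAff g → 7 ^ s * (P.filter fun x => ¬ NC g (cl x)).card ≤ 6 ^ s * P.card := by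
  induction s with
  | zero =>
    intro P
    refine ⟨fun _ => P, fun x hx => ⟨hx, subset_rfl, by simp⟩, fun g _ => ?_⟩
    simp only [pow_zero, one_mul]
    exact Finset.card_filter_le _ _
  | succ s ih =>
    intro P
    rcases P.eq_empty_or_nonempty with rfl | hP
    · exact ⟨fun _ => ∅, by simp, by simp⟩
    obtain ⟨κ, _, col, h1, h2⟩ := split_step P hP
    choose CL hCL1 hCL2 using ih
    set Pt : κ → Finset (ℝ × ℝ) := fun c => P.filter fun y => col y = c with hPt
    refine ⟨fun x => CL (Pt (col x)) x, ?_, ?_⟩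
    · intro x hx
      have hxm : x ∈ Pt (col x) := Finset.mem_filter.2 ⟨hx, rfl⟩
      obtain ⟨a, b, c⟩ := hCL1 (Pt (col x)) x hxm
      refine ⟨a, b.trans (Finset.filter_subset _ _), ?_⟩
      have := h1 x hx
      calc P.card ≤ 7 * (Pt (col x)).card := by convert this
        _ ≤ 7 * (7 ^ s * (CL (Pt (col x)) x).card) := by gcongr
        _ = _ := by ring
    · intro g hg
      obtain ⟨x0, hx0, hnc⟩ := h2 g hg
      set bad := P.filter fun x => ¬ NC g (CL (Pt (col x)) x) with hbad
      set I := P.image col with hI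
      have e1 : bad.card = ∑ c ∈ I, (bad.filter fun x => col x = c).card :=
        Finset.card_eq_sum_card_fiberwise (fun x hx => by
          have := (Finset.mem_filter.1 hx).1
          exact Finset.mem_coe.2 (Finset.mem_image_of_mem _ this))
      have e2 : P.card = ∑ c ∈ I, (Pt c).card :=
        Finset.card_eq_sum_card_fiberwise (fun x hx => 
          Finset.mem_coe.2 (Finset.mem_image_of_mem _ hx))
      have hc0 : col x0 ∈ I := Finset.mem_image_of_mem _ hx0
      have hfib : ∀ c, (bad.filter fun x => col x = c) = (Pt c).filter fun x => ¬ NC g (CL (Pt c) x) := by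
        intro c
        ext x
        simp only [hbad, hPt, Finset.mem_filter]
        constructor
        · rintro ⟨⟨a, b⟩, rfl⟩; exact ⟨⟨a, rfl⟩, b⟩
        · rintro ⟨⟨a, rfl⟩, b⟩; exact ⟨⟨a, b⟩, rfl⟩
      have hz : (bad.filter fun x => col x = col x0).card = 0 := by
        rw [hfib, Finset.card_eq_zero, Finset.filter_eq_empty_iff]
        intro x hx
        push Not
        exact NC.mono (by convert hnc) (hCL1 _ x hx).2.1
      have e3 : bad.card = ∑ c ∈ I.erase (col x0), (bad.filter fun x => col x = c).card := by
        rw [e1, ← Finset.add_sum_erase _ _ hc0, hz, zero_add]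
      have e4 : P.card = (Pt (col x0)).card + ∑ c ∈ I.erase (col x0), (Pt c).card := by
        rw [e2, ← Finset.add_sum_erase _ _ hc0]
      have e5 : 7 ^ s * bad.card ≤ 6 ^ s * ∑ c ∈ I.erase (col x0), (Pt c).card := by
        rw [e3, Finset.mul_sum, Finset.mul_sum]
        apply Finset.sum_le_sum
        intro c _
        rw [hfib]
        exact hCL2 (Pt c) g hg
      have e6 : P.card ≤ 7 * (Pt (col x0)).card := by convert h1 x0 hx0
      have e7 : 7 * ∑ c ∈ I.erase (col x0), (Pt c).card ≤ 6 * P.card := by omega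
      calc 7 ^ (s+1) * bad.card = 7 * (7 ^ s * bad.card) := by ring
        _ ≤ 7 * (6 ^ s * ∑ c ∈ I.erase (col x0), (Pt c).card) := by gcongr
        _ = 6 ^ s * (7 * ∑ c ∈ I.erase (col x0), (Pt c).card) := by ring
        _ ≤ 6 ^ s * (6 * P.card) := by gcongr
        _ = _ := by ring

def dF (p q r : ℝ × ℝ) : ℝ := (q.1 - p.1) * (r.2 - p.2) - (q.2 - p.2) * (r.1 - p.1)

theorem dF_aff (p q : ℝ × ℝ) : IsAff (dF p q) :=
  ⟨-(q.2 - p.2), q.1 - p.1, -(q.1 - p.1) * p.2 + (q.2 - p.2) * p.1, fun r => by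
    simp only [dF]; ring⟩

theorem dF_swap (p q r : ℝ × ℝ) : dF q p r = - dF p q r := by simp only [dF]; ring
theorem dF_rot (p q r : ℝ × ℝ) : dF q r p = dF p q r := by simp only [dF]; ring

/-- angular extremes of a set of vectors in an open half plane -/
theorem ang_ext (S : Finset (ℝ × ℝ)) (hS : S.Nonempty) (q0 z : ℝ × ℝ)
    (h : ∀ u ∈ S, 0 < dF q0 u z) :
    (∃ a ∈ S, ∀ u ∈ S, 0 ≤ dF q0 u a) ∧ (∃ a ∈ S, ∀ u ∈ S, dF q0 u a ≤ 0) := by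
  set ρ : ℝ × ℝ → ℝ := fun u =>
    ((u.1 - q0.1) * (z.1 - q0.1) + (u.2 - q0.2) * (z.2 - q0.2)) / dF q0 u z with hρ
  have key : ∀ a ∈ S, ∀ u ∈ S, ρ u ≤ ρ a → 0 ≤ dF q0 u a := by
    intro a ha u hu hle
    have h1 := h a ha
    have h2 := h u hu
    simp only [hρ] at hle
    rw [div_le_div_iff₀ h2 h1] at hle
    have hz : 0 < (z.1 - q0.1) ^ 2 + (z.2 - q0.2) ^ 2 := by
      by_contra hcon
      have e1 : z.1 - q0.1 = 0 := by nlinarith [sq_nonneg (z.1 - q0.1), sq_nonneg (z.2 - q0.2)]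
      have e2 : z.2 - q0.2 = 0 := by nlinarith [sq_nonneg (z.1 - q0.1), sq_nonneg (z.2 - q0.2)]
      simp only [dF, e1, e2] at h1
      linarith
    have : 0 ≤ ((z.1 - q0.1) ^ 2 + (z.2 - q0.2) ^ 2) * dF q0 u a := by
      simp only [dF] at hle ⊢
      nlinarith
    exact nonneg_of_mul_nonneg_right this hz
  constructor
  · obtain ⟨a, ha, hm⟩ := S.exists_max_image ρ hS
    exact ⟨a, ha, fun u hu => key a ha u hu (hm u hu)⟩
  · obtain ⟨a, ha, hm⟩ := S.exists_min_image ρ hS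
    refine ⟨a, ha, fun u hu => ?_⟩
    have := key u hu a ha (hm u hu)
    have e : dF q0 u a = - dF q0 a u := by simp only [dF]; ring
    linarith

theorem min_pair (A B : Finset (ℝ × ℝ)) (hA : A.Nonempty) (hB : B.Nonempty) (q0 q' : ℝ × ℝ)
    (h : ∀ u ∈ A, ∀ w ∈ B, 0 < dF u w q0) :
    ∃ u1 ∈ A, ∃ w1 ∈ B, (∀ u ∈ A, dF u1 w1 u * dF q0 q' w1 ≤ 0) ∧
      (∀ w ∈ B, 0 ≤ dF u1 w1 w * dF q0 q' u1) := by
  obtain ⟨⟨u1, w1⟩, hm, hmin⟩ := (A ×ˢ B).exists_min_image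
    (fun z => dF z.1 z.2 q' / dF z.1 z.2 q0) (hA.product hB)
  rw [Finset.mem_product] at hm
  refine ⟨u1, hm.1, w1, hm.2, ?_, ?_⟩
  · intro u hu
    have := hmin (u, w1) (Finset.mem_product.2 ⟨hu, hm.2⟩)
    simp only at this
    rw [div_le_div_iff₀ (h _ hm.1 _ hm.2) (h _ hu _ hm.2)] at this
    have e : dF u w1 q' * dF u1 w1 q0 - dF u1 w1 q' * dF u w1 q0
        = - (dF u1 w1 u * dF q0 q' w1) := by simp only [dF]; ring
    linarith
  · intro w hw
    have := hmin (u1, w) (Finset.mem_product.2 ⟨hm.1, hw⟩)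
    simp only at this
    rw [div_le_div_iff₀ (h _ hm.1 _ hm.2) (h _ hm.1 _ hw)] at this
    have e : dF u1 w q' * dF u1 w1 q0 - dF u1 w1 q' * dF u1 w q0
        = (dF u1 w1 w * dF q0 q' u1) := by simp only [dF]; ring
    linarith

theorem pos_tangents (A B : Finset (ℝ × ℝ)) (hA : A.Nonempty) (hB : B.Nonempty) (q0 : ℝ × ℝ)
    (h : ∀ u ∈ A, ∀ w ∈ B, 0 < dF u w q0) :
    ∃ f : Fin 3 → (ℝ × ℝ) × (ℝ × ℝ), (∀ i, (f i).1 ∈ A ∧ (f i).2 ∈ B) ∧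
      ∀ q, (∀ i, 0 < dF (f i).1 (f i).2 q) → ∀ u ∈ A, ∀ w ∈ B, 0 < dF u w q := by
  obtain ⟨u0, hu0⟩ := id hA
  obtain ⟨w0, hw0⟩ := id hB
  obtain ⟨⟨us, hus, hus'⟩, _⟩ := ang_ext A hA q0 w0 (fun u hu => by
    rw [dF_rot]; rw [dF_rot]; exact h u hu w0 hw0)
  obtain ⟨⟨ws, hws, hws'⟩, _⟩ : (∃ a ∈ B, ∀ u ∈ B, dF q0 u a ≤ 0) ∧ True := by
    refine ⟨(ang_ext B hB q0 (q0.1 - (u0.1 - q0.1), q0.2 - (u0.2 - q0.2)) (fun w hw => ?_)).2,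
      trivial⟩
    have := h u0 hu0 w hw
    have e : dF q0 w (q0.1 - (u0.1 - q0.1), q0.2 - (u0.2 - q0.2)) = dF u0 w q0 := by
      simp only [dF]; ring
    rw [e]; exact this
  -- separating direction
  set f : ℝ × ℝ := (us.1 + ws.1 - q0.1, us.2 + ws.2 - q0.2) with hf
  have hfA : ∀ u ∈ A, dF q0 f u < 0 := by
    intro u hu
    have h1 := hus' u hu
    have h2 := h u hu ws hws
    have e : dF q0 f u = - dF q0 u us - dF u ws q0 := by simp only [dF, hf]; ring
    linarith
  have hfB : ∀ w ∈ B, 0 < dF q0 f w := by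
    intro w hw
    have h1 := hws' w hw
    have h2 := h us hus w hw
    have e : dF q0 f w = - dF q0 w ws + dF us w q0 := by simp only [dF, hf]; ring
    linarith
  obtain ⟨u3, hu3, w3, hw3, g3A, g3B⟩ := min_pair A B hA hB q0 f h
  have G3A : ∀ u ∈ A, dF u3 w3 u ≤ 0 := fun u hu => by
    have := g3A u hu; have := hfB w3 hw3; nlinarith
  have G3B : ∀ w ∈ B, dF u3 w3 w ≤ 0 := fun w hw => by
    have := g3B w hw; have := hfA u3 hu3; nlinarith
  have h30 := h u3 hu3 w3 hw3
  set e : ℝ × ℝ := (q0.1 + (w3.1 - u3.1), q0.2 + (w3.2 - u3.2)) with he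
  set e' : ℝ × ℝ := (q0.1 - (w3.1 - u3.1), q0.2 - (w3.2 - u3.2)) with he'
  have ee : ∀ p, dF q0 e p = dF u3 w3 p - dF u3 w3 q0 := by
    intro p; simp only [dF, he]; ring
  have ee' : ∀ p, dF q0 e' p = - (dF u3 w3 p - dF u3 w3 q0) := by
    intro p; simp only [dF, he']; ring
  have heA : ∀ u ∈ A, dF q0 e u < 0 := fun u hu => by rw [ee]; linarith [G3A u hu]
  have heB : ∀ u ∈ B, dF q0 e u < 0 := fun u hu => by rw [ee]; linarith [G3B u hu]
  have heA' : ∀ u ∈ A, 0 < dF q0 e' u := fun u hu => by rw [ee']; linarith [G3A u hu]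
  have heB' : ∀ u ∈ B, 0 < dF q0 e' u := fun u hu => by rw [ee']; linarith [G3B u hu]
  obtain ⟨u1, hu1, w1, hw1, g1A, g1B⟩ := min_pair A B hA hB q0 e h
  obtain ⟨u2, hu2, w2, hw2, g2A, g2B⟩ := min_pair A B hA hB q0 e' h
  have G1A : ∀ u ∈ A, 0 ≤ dF u1 w1 u := fun u hu => by
    have := g1A u hu; have := heB w1 hw1; nlinarith
  have G1B : ∀ w ∈ B, dF u1 w1 w ≤ 0 := fun w hw => by
    have := g1B w hw; have := heA u1 hu1; nlinarith
  have G2A : ∀ u ∈ A, dF u2 w2 u ≤ 0 := fun u hu => by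
    have := g2A u hu; have := heB' w2 hw2; nlinarith
  have G2B : ∀ w ∈ B, 0 ≤ dF u2 w2 w := fun w hw => by
    have := g2B w hw; have := heA' u2 hu2; nlinarith
  refine ⟨![(u1, w1), (u2, w2), (u3, w3)], ?_, ?_⟩
  · intro i
    fin_cases i
    · exact ⟨hu1, hw1⟩
    · exact ⟨hu2, hw2⟩
    · exact ⟨hu3, hw3⟩
  · intro q hq u hu w hw
    have q1 : 0 < dF u1 w1 q := hq 0
    have q2 : 0 < dF u2 w2 q := hq 1
    have q3 : 0 < dF u3 w3 q := hq 2
    have hd := h u hu w hw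
    -- barycentric coordinates of q with respect to q0, u, w
    have bary : ∀ x y, dF u w q0 * dF x y q = dF u w q * dF x y q0 + dF w q0 q * dF x y u
        + dF q0 u q * dF x y w := by
      intro x y; simp only [dF]; ring
    by_contra hcon
    push Not at hcon
    have m1 : 0 < dF u w q0 * dF u1 w1 q := mul_pos hd q1
    have m2 : 0 < dF u w q0 * dF u2 w2 q := mul_pos hd q2
    have m3 : 0 < dF u w q0 * dF u3 w3 q := mul_pos hd q3
    rw [bary] at m1 m2 m3
    have n1 := mul_nonneg (neg_nonneg.2 hcon) (h u1 hu1 w1 hw1).le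
    have n2 := mul_nonneg (neg_nonneg.2 hcon) (h u2 hu2 w2 hw2).le
    have n3 := mul_nonneg (neg_nonneg.2 hcon) (h u3 hu3 w3 hw3).le
    have sum1 : dF u w q + dF w q0 q + dF q0 u q = dF u w q0 := by simp only [dF]; ring
    rcases le_total 0 (dF w q0 q) with hs | hs <;> rcases le_total 0 (dF q0 u q) with ht | ht
    · have := mul_nonneg hs (neg_nonneg.2 (G3A u hu))
      have := mul_nonneg ht (neg_nonneg.2 (G3B w hw))
      linarith
    · have := mul_nonneg hs (neg_nonneg.2 (G2A u hu))
      have := mul_nonneg (neg_nonneg.2 ht) (G2B w hw)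
      linarith
    · have := mul_nonneg (neg_nonneg.2 hs) (G1A u hu)
      have := mul_nonneg ht (neg_nonneg.2 (G1B w hw))
      linarith
    · linarith

def Good (A B C : Finset (ℝ × ℝ)) : Prop :=
  (∀ a ∈ A, ∀ b ∈ B, ∀ c ∈ C, 0 ≤ dF a b c) ∨ (∀ a ∈ A, ∀ b ∈ B, ∀ c ∈ C, dF a b c ≤ 0)

theorem Good.swap {A B C : Finset (ℝ × ℝ)} (h : Good A B C) : Good B A C := by
  rcases h with h | h
  · right; intro b hb a ha c hc; rw [dF_swap]; linarith [h a ha b hb c hc]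
  · left; intro b hb a ha c hc; rw [dF_swap]; linarith [h a ha b hb c hc]

theorem Good.rot {A B C : Finset (ℝ × ℝ)} (h : Good A B C) : Good B C A := by
  rcases h with h | h
  · left; intro b hb c hc a ha; rw [dF_rot]; exact h a ha b hb c hc
  · right; intro b hb c hc a ha; rw [dF_rot]; exact h a ha b hb c hc

theorem good_single {x y : ℝ × ℝ} {Q : Finset (ℝ × ℝ)} (h : NC (dF x y) Q) : Good {x} {y} Q := by
  rcases h with h | h
  · left; simpa using h
  · right; simpa using h

theorem three_fun (A B R : Finset (ℝ × ℝ)) (hA : A.Nonempty) (hB : B.Nonempty)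
    (hne : ∀ u ∈ A, ∀ w ∈ B, ∀ q ∈ R, dF u w q ≠ 0) :
    ∃ G : Fin 3 → ℝ × ℝ → ℝ, (∀ i, IsAff (G i)) ∧
      ∀ Q ⊆ R, (∀ i, NC (G i) Q) → (∃ q ∈ Q, ∀ u ∈ A, ∀ w ∈ B, 0 < dF u w q) →
        ∀ q ∈ Q, ∀ u ∈ A, ∀ w ∈ B, 0 < dF u w q := by
  by_cases hq0 : ∃ q0, ∀ u ∈ A, ∀ w ∈ B, 0 < dF u w q0
  · obtain ⟨q0, hq0⟩ := hq0
    obtain ⟨f, hf1, hf2⟩ := pos_tangents A B hA hB q0 hq0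
    refine ⟨fun i => dF (f i).1 (f i).2, fun i => dF_aff _ _, ?_⟩
    rintro Q hQ hnc ⟨q1, hq1, hpos⟩ q hq
    apply hf2
    intro i
    have h1 := hpos _ (hf1 i).1 _ (hf1 i).2
    have h2 := hne _ (hf1 i).1 _ (hf1 i).2 q (hQ hq)
    rcases hnc i with h | h
    · exact lt_of_le_of_ne (h q hq) h2.symm
    · exact absurd (h q1 hq1) (not_le.2 h1)
  · refine ⟨fun _ _ => 0, fun i => ⟨0, 0, 0, by simp⟩, ?_⟩
    rintro Q _ _ ⟨q, _, h⟩
    exact absurd ⟨q, h⟩ hq0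

theorem six_fun (A B R : Finset (ℝ × ℝ)) (hA : A.Nonempty) (hB : B.Nonempty)
    (hne : (∀ u ∈ A, ∀ w ∈ B, ∀ q ∈ R, dF u w q ≠ 0) ∨
      (∀ u ∈ A, ∀ w ∈ B, ∀ q ∈ R, dF u w q = 0)) :
    ∃ G : Fin 3 ⊕ Fin 3 → ℝ × ℝ → ℝ, (∀ i, IsAff (G i)) ∧
      ∀ Q ⊆ R, (∀ i, NC (G i) Q) → Good A B Q ∨ ∀ q ∈ Q, ¬ Good A B {q} := by
  rcases hne with hne | h0
  · obtain ⟨G1, a1, b1⟩ := three_fun A B R hA hB hne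
    obtain ⟨G2, a2, b2⟩ := three_fun B A R hB hA (fun u hu w hw q hq => by
      rw [dF_swap]; exact neg_ne_zero.2 (hne w hw u hu q hq))
    refine ⟨Sum.elim G1 G2, ?_, ?_⟩
    · rintro (i | i)
      · exact a1 i
      · exact a2 i
    · intro Q hQ hnc
      by_cases hex : ∃ q ∈ Q, Good A B {q}
      · left
        obtain ⟨q, hq, hg | hg⟩ := hex
        · left
          have := b1 Q hQ (fun i => hnc (Sum.inl i)) ⟨q, hq, fun u hu w hw =>
            lt_of_le_of_ne (hg u hu w hw q (by simp)) (hne u hu w hw q (hQ hq)).symm⟩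
          exact fun u hu w hw c hc => (this c hc u hu w hw).le
        · right
          have := b2 Q hQ (fun i => hnc (Sum.inr i)) ⟨q, hq, fun w hw u hu => by
            rw [dF_swap]
            have := lt_of_le_of_ne (hg u hu w hw q (by simp)) (hne u hu w hw q (hQ hq))
            linarith⟩
          intro u hu w hw c hc
          have := this c hc w hw u hu
          rw [dF_swap] at this
          linarith
      · right
        intro q hq hg
        exact hex ⟨q, hq, hg⟩
  · refine ⟨fun _ _ => 0, fun i => ⟨0, 0, 0, by simp⟩, ?_⟩
    intro Q hQ _
    left; left
    intro u hu w hw c hc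
    rw [h0 u hu w hw c (hQ hc)]

open Classical in
theorem markov_count {α β : Type} (X : Finset α) (Y : Finset β) (hY : Y.Nonempty)
    (r : α → β → Prop) (c δ : ℝ) (hδ : 0 < δ)
    (h : (∑ y ∈ Y, ((X.filter fun x => ¬ r x y).card : ℝ)) ≤ c * X.card * Y.card) :
    ((X.filter fun x => ¬ (((Y.filter fun y => ¬ r x y).card : ℝ) ≤ δ * Y.card)).card : ℝ)
      ≤ c / δ * X.card := by
  have hYc : (0 : ℝ) < Y.card := by exact_mod_cast hY.card_pos
  have e : (∑ y ∈ Y, ((X.filter fun x => ¬ r x y).card : ℝ))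
      = ∑ x ∈ X, ((Y.filter fun y => ¬ r x y).card : ℝ) := by
    simp only [Finset.card_filter, Nat.cast_sum]
    exact Finset.sum_comm
  rw [e] at h
  set Z := X.filter fun x => ¬ (((Y.filter fun y => ¬ r x y).card : ℝ) ≤ δ * Y.card) with hZ
  have h2 : (Z.card : ℝ) * (δ * Y.card) ≤ ∑ x ∈ X, ((Y.filter fun y => ¬ r x y).card : ℝ) := by
    calc (Z.card : ℝ) * (δ * Y.card) = ∑ x ∈ Z, δ * (Y.card : ℝ) := by
          rw [Finset.sum_const, nsmul_eq_mul]
      _ ≤ ∑ x ∈ Z, ((Y.filter fun y => ¬ r x y).card : ℝ) := by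
          apply Finset.sum_le_sum
          intro x hx
          have := (Finset.mem_filter.1 hx).2
          push Not at this
          exact this.le
      _ ≤ _ := by
          apply Finset.sum_le_sum_of_subset_of_nonneg (Finset.filter_subset _ _)
          intros; positivity
  have h3 : (Z.card : ℝ) * δ * Y.card ≤ c * X.card * Y.card := by linarith
  have h4 : (Z.card : ℝ) * δ ≤ c * X.card := le_of_mul_le_mul_right h3 hYc
  rw [div_mul_eq_mul_div, le_div_iff₀ hδ]
  exact h4

open Classical in
structure TInv {k : ℕ} (P : Fin k → Finset (ℝ × ℝ)) (s : ℕ) (δ1 δ2 : ℝ) (T : Finset (Fin k))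
    (Q : Fin k → Finset (ℝ × ℝ)) : Prop where
  sub : ∀ a ∈ T, Q a ⊆ P a
  ne : ∀ a ∈ T, (Q a).Nonempty
  card : ∀ a ∈ T, (P a).card ≤ 7 ^ s * (Q a).card
  i1 : ∀ a ∈ T, ∀ i ∉ T, ∀ j ∉ T, i ≠ j →
    (((P i ×ˢ P j).filter fun z => ¬ Good {z.1} {z.2} (Q a)).card : ℝ)
      ≤ δ1 * ((P i ×ˢ P j).card : ℝ)
  i2 : ∀ a ∈ T, ∀ b ∈ T, a ≠ b → ∀ j ∉ T,
    (((P j).filter fun y => ¬ Good (Q a) (Q b) {y}).card : ℝ) ≤ δ2 * (P j).card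
  i3 : ∀ a ∈ T, ∀ b ∈ T, ∀ c ∈ T, a ≠ b → a ≠ c → b ≠ c → Good (Q a) (Q b) (Q c)

open Classical in
theorem six_count (A B R : Finset (ℝ × ℝ)) (hA : A.Nonempty) (hB : B.Nonempty)
    (hne : (∀ u ∈ A, ∀ w ∈ B, ∀ q ∈ R, dF u w q ≠ 0) ∨
      (∀ u ∈ A, ∀ w ∈ B, ∀ q ∈ R, dF u w q = 0))
    (cl : ℝ × ℝ → Finset (ℝ × ℝ)) (η : ℝ) (hcl : ∀ x ∈ R, x ∈ cl x ∧ cl x ⊆ R)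
    (hη : ∀ g, IsAff g → ((R.filter fun x => ¬ NC g (cl x)).card : ℝ) ≤ η * R.card) :
    ((R.filter fun x => ¬ Good A B (cl x)).card : ℝ) ≤
      6 * η * R.card + ((R.filter fun x => ¬ Good A B {x}).card : ℝ) := by
  obtain ⟨G, hG1, hG2⟩ := six_fun A B R hA hB hne
  have hsub : (R.filter fun x => ¬ Good A B (cl x)) ⊆
      ((Finset.univ : Finset (Fin 3 ⊕ Fin 3)).biUnion fun i => R.filter fun x => ¬ NC (G i) (cl x))
        ∪ (R.filter fun x => ¬ Good A B {x}) := by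
    intro x hx
    rw [Finset.mem_filter] at hx
    rw [Finset.mem_union, Finset.mem_biUnion, Finset.mem_filter]
    by_contra hcon
    push Not at hcon
    have h1 : ∀ i, NC (G i) (cl x) := by
      intro i
      have := hcon.1 i (Finset.mem_univ _)
      by_contra h
      exact this (Finset.mem_filter.2 ⟨hx.1, h⟩)
    rcases hG2 (cl x) (hcl x hx.1).2 h1 with h | h
    · exact hx.2 h
    · exact h x (hcl x hx.1).1 (hcon.2 hx.1)
  have h1 := Finset.card_le_card hsub
  have h2 := h1.trans (Finset.card_union_le _ _)
  have h3 : (((Finset.univ : Finset (Fin 3 ⊕ Fin 3)).biUnion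
      fun i => R.filter fun x => ¬ NC (G i) (cl x)).card : ℝ) ≤ 6 * η * R.card := by
    calc _ ≤ ((∑ i : Fin 3 ⊕ Fin 3, (R.filter fun x => ¬ NC (G i) (cl x)).card : ℕ) : ℝ) := by
          exact_mod_cast Finset.card_biUnion_le
      _ = ∑ i : Fin 3 ⊕ Fin 3, ((R.filter fun x => ¬ NC (G i) (cl x)).card : ℝ) := by push_cast; rfl
      _ ≤ ∑ i : Fin 3 ⊕ Fin 3, η * R.card := Finset.sum_le_sum fun i _ => hη _ (hG1 i)
      _ = _ := by
          rw [Finset.sum_const, nsmul_eq_mul, Finset.card_univ]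
          simp only [Fintype.card_sum, Fintype.card_fin]
          push_cast; ring
  have h4 : ((R.filter fun x => ¬ Good A B (cl x)).card : ℝ) ≤ 
    (((Finset.univ : Finset (Fin 3 ⊕ Fin 3)).biUnion
      fun i => R.filter fun x => ¬ NC (G i) (cl x)).card : ℝ) + 
      ((R.filter fun x => ¬ Good A B {x}).card : ℝ) := by exact_mod_cast h2
  linarith

open Classical in
theorem step {k : ℕ} (P : Fin k → Finset (ℝ × ℝ)) (hP : ∀ i, (P i).Nonempty)
    (hTri : ∀ i j l, i ≠ j → i ≠ l → j ≠ l →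
      (∀ u ∈ P i, ∀ w ∈ P j, ∀ q ∈ P l, dF u w q ≠ 0) ∨
      (∀ u ∈ P i, ∀ w ∈ P j, ∀ q ∈ P l, dF u w q = 0))
    (s : ℕ) (δ1 δ2 η : ℝ) (hδ1 : 0 < δ1) (hδ2 : 0 < δ2) (hη0 : 0 ≤ η) (hηs : (6 / 7 : ℝ) ^ s ≤ η)
    (hsmall : (k : ℝ) ^ 2 * (η / δ1 + (6 * η + δ1) / δ2 + (6 * η + δ2)) < 1)
    (T : Finset (Fin k)) (t : Fin k) (ht : t ∉ T) (Q : Fin k → Finset (ℝ × ℝ))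
    (hQ : TInv P s δ1 δ2 T Q) : ∃ Q', TInv P s δ1 δ2 (insert t T) Q' := by
  obtain ⟨cl, hcl, hcr⟩ := class_exists s (P t)
  have hcr' : ∀ g, IsAff g → (((P t).filter fun x => ¬ NC g (cl x)).card : ℝ) ≤ η * (P t).card := by
    intro g hg
    have h1 := hcr g hg
    have h2 : (7 : ℝ) ^ s * (((P t).filter fun x => ¬ NC g (cl x)).card : ℝ)
        ≤ 6 ^ s * (P t).card := by exact_mod_cast h1
    have h3 : (((P t).filter fun x => ¬ NC g (cl x)).card : ℝ) ≤ (6 / 7 : ℝ) ^ s * (P t).card := by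
      rw [div_pow, div_mul_eq_mul_div, le_div_iff₀ (by positivity)]
      linarith
    exact h3.trans (by gcongr)
  have hcl' : ∀ x ∈ P t, x ∈ cl x ∧ cl x ⊆ P t := fun x hx => ⟨(hcl x hx).1, (hcl x hx).2.1⟩
  -- the three conditions
  let C1 : Fin k → Fin k → ℝ × ℝ → Prop := fun i j x => i ≠ j → i ≠ t → j ≠ t →
    (((P i ×ˢ P j).filter fun z => ¬ Good {z.1} {z.2} (cl x)).card : ℝ)
      ≤ δ1 * ((P i ×ˢ P j).card : ℝ)
  let C2 : Fin k → Fin k → ℝ × ℝ → Prop := fun a j x => a ∈ T → j ∉ T → j ≠ t →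
    (((P j).filter fun y => ¬ Good (Q a) {y} (cl x)).card : ℝ) ≤ δ2 * (P j).card
  let C3 : Fin k → Fin k → ℝ × ℝ → Prop := fun a b x => a ∈ T → b ∈ T → a ≠ b →
    Good (Q a) (Q b) (cl x)
  have hPt : (0 : ℝ) < (P t).card := by exact_mod_cast (hP t).card_pos
  have B1 : ∀ i j, (((P t).filter fun x => ¬ C1 i j x).card : ℝ) ≤ η / δ1 * (P t).card := by
    intro i j
    by_cases hc : i ≠ j ∧ i ≠ t ∧ j ≠ t
    · have := markov_count (P t) (P i ×ˢ P j) ((hP i).product (hP j))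
        (fun x z => Good {z.1} {z.2} (cl x)) η δ1 hδ1 (by
          calc _ ≤ ∑ z ∈ P i ×ˢ P j, η * ((P t).card : ℝ) := by
                apply Finset.sum_le_sum
                intro z _
                refine le_trans ?_ (hcr' (dF z.1 z.2) (dF_aff _ _))
                have : ((P t).filter fun x => ¬ Good {z.1} {z.2} (cl x)) ⊆
                    (P t).filter fun x => ¬ NC (dF z.1 z.2) (cl x) := by
                  intro x hx
                  rw [Finset.mem_filter] at hx ⊢
                  exact ⟨hx.1, fun h => hx.2 (good_single h)⟩
                exact_mod_cast Finset.card_le_card this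
            _ = _ := by rw [Finset.sum_const, nsmul_eq_mul]; ring)
      refine le_trans ?_ this
      have hs : ((P t).filter fun x => ¬ C1 i j x) ⊆ ((P t).filter fun x =>
        ¬ ((((P i ×ˢ P j).filter fun z => ¬ Good {z.1} {z.2} (cl x)).card : ℝ)
          ≤ δ1 * ((P i ×ˢ P j).card : ℝ))) := by
        intro x hx
        rw [Finset.mem_filter] at hx ⊢
        exact ⟨hx.1, fun h => hx.2 fun _ _ _ => h⟩
      exact_mod_cast Finset.card_le_card hs
    · have : ((P t).filter fun x => ¬ C1 i j x) = ∅ := by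
        rw [Finset.filter_eq_empty_iff]
        intro x _ h
        exact h fun h1 h2 h3 => (hc ⟨h1, h2, h3⟩).elim
      rw [this]; simp; positivity
  have B2 : ∀ a j, (((P t).filter fun x => ¬ C2 a j x).card : ℝ)
      ≤ (6 * η + δ1) / δ2 * (P t).card := by
    intro a j
    by_cases hc : a ∈ T ∧ j ∉ T ∧ j ≠ t
    · obtain ⟨ha, hj, hjt⟩ := hc
      have haj : a ≠ j := fun h => hj (h ▸ ha)
      have hat : a ≠ t := fun h => ht (h ▸ ha)
      have := markov_count (P t) (P j) (hP j)
        (fun x y => Good (Q a) {y} (cl x)) (6 * η + δ1) δ2 hδ2 (by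
          calc _ ≤ ∑ y ∈ P j, (6 * η * ((P t).card : ℝ) +
                  (((P t).filter fun x => ¬ Good (Q a) {y} {x}).card : ℝ)) := by
                apply Finset.sum_le_sum
                intro y hy
                apply six_count (Q a) {y} (P t) (hQ.ne a ha) (by simp) _ cl η hcl' hcr'
                rcases hTri a j t haj hat hjt with h | h
                · left; intro u hu w hw q hq
                  rw [Finset.mem_singleton] at hw
                  exact h u (hQ.sub a ha hu) w (hw ▸ hy) q hq
                · right; intro u hu w hw q hq
                  rw [Finset.mem_singleton] at hw
                  exact h u (hQ.sub a ha hu) w (hw ▸ hy) q hq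
            _ = 6 * η * (P t).card * (P j).card + 
                ∑ y ∈ P j, (((P t).filter fun x => ¬ Good (Q a) {y} {x}).card : ℝ) := by
                rw [Finset.sum_add_distrib, Finset.sum_const, nsmul_eq_mul]; ring
            _ ≤ 6 * η * (P t).card * (P j).card + δ1 * ((P t ×ˢ P j).card : ℝ) := by
                gcongr
                refine le_trans ?_ (hQ.i1 a ha t ht j hj hjt.symm)
                have e : (((P t ×ˢ P j).filter fun z => ¬ Good {z.1} {z.2} (Q a)).card : ℝ)
                  = ∑ y ∈ P j, (((P t).filter fun x => ¬ Good {x} {y} (Q a)).card : ℝ) := by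
                  simp only [Finset.card_filter, Nat.cast_sum]
                  rw [Finset.sum_product, Finset.sum_comm]
                rw [e]
                apply Finset.sum_le_sum
                intro y _
                have : ((P t).filter fun x => ¬ Good (Q a) {y} {x}) ⊆ 
                    ((P t).filter fun x => ¬ Good {x} {y} (Q a)) := by
                  intro x hx
                  rw [Finset.mem_filter] at hx ⊢
                  exact ⟨hx.1, fun h => hx.2 h.rot.swap⟩
                exact_mod_cast Finset.card_le_card this
            _ = _ := by rw [Finset.card_product]; push_cast; ring)
      refine le_trans ?_ this
      have hs : ((P t).filter fun x => ¬ C2 a j x) ⊆ ((P t).filter fun x =>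
        ¬ ((((P j).filter fun y => ¬ Good (Q a) {y} (cl x)).card : ℝ)
          ≤ δ2 * ((P j).card : ℝ))) := by
        intro x hx
        rw [Finset.mem_filter] at hx ⊢
        exact ⟨hx.1, fun h => hx.2 fun _ _ _ => h⟩
      exact_mod_cast Finset.card_le_card hs
    · have : ((P t).filter fun x => ¬ C2 a j x) = ∅ := by
        rw [Finset.filter_eq_empty_iff]
        intro x _ h
        exact h fun h1 h2 h3 => (hc ⟨h1, h2, h3⟩).elim
      rw [this]; simp; positivity
  have B3 : ∀ a b, (((P t).filter fun x => ¬ C3 a b x).card : ℝ)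
      ≤ (6 * η + δ2) * (P t).card := by
    intro a b
    by_cases hc : a ∈ T ∧ b ∈ T ∧ a ≠ b
    · obtain ⟨ha, hb, hab⟩ := hc
      have hbt : b ≠ t := fun h => ht (h ▸ hb)
      have hat : a ≠ t := fun h => ht (h ▸ ha)
      have h1 := six_count (Q a) (Q b) (P t) (hQ.ne a ha) (hQ.ne b hb) (by
        rcases hTri a b t hab hat hbt with h | h
        · left; intro u hu w hw q hq
          exact h u (hQ.sub a ha hu) w (hQ.sub b hb hw) q hq
        · right; intro u hu w hw q hq
          exact h u (hQ.sub a ha hu) w (hQ.sub b hb hw) q hq) cl η hcl' hcr'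
      have h2 := hQ.i2 a ha b hb hab t ht
      have hs : ((P t).filter fun x => ¬ C3 a b x) ⊆ ((P t).filter fun x =>
        ¬ Good (Q a) (Q b) (cl x)) := by
        intro x hx
        rw [Finset.mem_filter] at hx ⊢
        exact ⟨hx.1, fun h => hx.2 fun _ _ _ => h⟩
      have h3 : (((P t).filter fun x => ¬ C3 a b x).card : ℝ) ≤ ((P t).filter fun x =>
        ¬ Good (Q a) (Q b) (cl x)).card := by exact_mod_cast Finset.card_le_card hs
      linarith
    · have : ((P t).filter fun x => ¬ C3 a b x) = ∅ := by
        rw [Finset.filter_eq_empty_iff]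
        intro x _ h
        exact h fun h1 h2 h3 => (hc ⟨h1, h2, h3⟩).elim
      rw [this]; simp; positivity
  obtain ⟨x, hx, hgood⟩ : ∃ x ∈ P t, ∀ i j, C1 i j x ∧ C2 i j x ∧ C3 i j x := by
    by_contra hcon
    push Not at hcon
    have hsub : P t ⊆ (Finset.univ : Finset (Fin k × Fin k)).biUnion fun z =>
        ((P t).filter fun x => ¬ C1 z.1 z.2 x) ∪ (((P t).filter fun x => ¬ C2 z.1 z.2 x) ∪
          ((P t).filter fun x => ¬ C3 z.1 z.2 x)) := by
      intro x hx
      obtain ⟨i, j, hij⟩ := hcon x hx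
      rw [Finset.mem_biUnion]
      refine ⟨(i, j), Finset.mem_univ _, ?_⟩
      simp only [Finset.mem_union, Finset.mem_filter]
      by_contra h
      push Not at h
      exact hij (h.1 hx) (h.2.1 hx) (h.2.2 hx)
    have h1 : ((P t).card : ℝ) ≤ ∑ z : Fin k × Fin k, 
        ((η / δ1 + (6 * η + δ1) / δ2 + (6 * η + δ2)) * (P t).card) := by
      calc ((P t).card : ℝ) ≤ ((∑ z : Fin k × Fin k, (((P t).filter fun x => ¬ C1 z.1 z.2 x) ∪ (((P t).filter fun x => ¬ C2 z.1 z.2 x) ∪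
          ((P t).filter fun x => ¬ C3 z.1 z.2 x))).card : ℕ) : ℝ) := by
            exact_mod_cast (Finset.card_le_card hsub).trans Finset.card_biUnion_le
        _ = ∑ z : Fin k × Fin k, ((((P t).filter fun x => ¬ C1 z.1 z.2 x) ∪ (((P t).filter fun x => ¬ C2 z.1 z.2 x) ∪
          ((P t).filter fun x => ¬ C3 z.1 z.2 x))).card : ℝ) := by push_cast; rfl
        _ ≤ _ := by
          apply Finset.sum_le_sum
          intro z _
          have a1 := B1 z.1 z.2
          have a2 := B2 z.1 z.2
          have a3 := B3 z.1 z.2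
          have b1 := Finset.card_union_le ((P t).filter fun x => ¬ C1 z.1 z.2 x) (((P t).filter fun x => ¬ C2 z.1 z.2 x) ∪
          ((P t).filter fun x => ¬ C3 z.1 z.2 x))
          have b2 := Finset.card_union_le ((P t).filter fun x => ¬ C2 z.1 z.2 x)
           ((P t).filter fun x => ¬ C3 z.1 z.2 x)
          have b3 := b1.trans (Nat.add_le_add_left b2 _)
          have b4 : ((((P t).filter fun x => ¬ C1 z.1 z.2 x) ∪ (((P t).filter fun x => ¬ C2 z.1 z.2 x) ∪
            ((P t).filter fun x => ¬ C3 z.1 z.2 x))).card : ℝ) ≤ 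
            ((P t).filter fun x => ¬ C1 z.1 z.2 x).card + (((P t).filter fun x => ¬ C2 z.1 z.2 x).card + ((P t).filter fun x => ¬ C3 z.1 z.2 x).card) := by exact_mod_cast b3
          linarith
    rw [Finset.sum_const, nsmul_eq_mul, Finset.card_univ, Fintype.card_prod, Fintype.card_fin] at h1
    push_cast at h1
    have h2 := mul_lt_mul_of_pos_right hsmall hPt
    linarith
  have hx' := hcl x hx
  have hut : Function.update Q t (cl x) t = cl x := Function.update_self _ _ _
  have hua : ∀ a ∈ T, Function.update Q t (cl x) a = Q a := fun a ha =>
    Function.update_of_ne (fun h : a = t => ht (h ▸ ha)) _ _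
  refine ⟨Function.update Q t (cl x), ?_, ?_, ?_, ?_, ?_, ?_⟩
  · intro a ha
    rcases Finset.mem_insert.1 ha with rfl | ha2
    · rw [hut]; exact hx'.2.1
    · rw [hua a ha2]; exact hQ.sub a ha2
  · intro a ha
    rcases Finset.mem_insert.1 ha with rfl | ha2
    · rw [hut]; exact ⟨x, hx'.1⟩
    · rw [hua a ha2]; exact hQ.ne a ha2
  · intro a ha
    rcases Finset.mem_insert.1 ha with rfl | ha2
    · rw [hut]; exact hx'.2.2
    · rw [hua a ha2]; exact hQ.card a ha2
  · intro a ha i hi j hj hij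
    rw [Finset.mem_insert, not_or] at hi hj
    rcases Finset.mem_insert.1 ha with rfl | ha2
    · rw [hut]; exact (hgood i j).1 hij hi.1 hj.1
    · rw [hua a ha2]; exact hQ.i1 a ha2 i hi.2 j hj.2 hij
  · intro a ha b hb hab j hj
    rw [Finset.mem_insert, not_or] at hj
    have key : ∀ a ∈ T, (((P j).filter fun y => ¬ Good (Q a) (cl x) {y}).card : ℝ)
        ≤ δ2 * (P j).card := by
      intro a ha
      refine le_trans ?_ ((hgood a j).2.1 ha hj.2 hj.1)
      have : ((P j).filter fun y => ¬ Good (Q a) (cl x) {y}) ⊆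
          ((P j).filter fun y => ¬ Good (Q a) {y} (cl x)) := by
        intro y hy
        rw [Finset.mem_filter] at hy ⊢
        exact ⟨hy.1, fun h => hy.2 h.rot.rot.swap⟩
      exact_mod_cast Finset.card_le_card this
    rcases Finset.mem_insert.1 ha with rfl | ha2
    · rcases Finset.mem_insert.1 hb with rfl | hb
      · exact (hab rfl).elim
      · rw [hut, hua b hb]
        refine le_trans ?_ (key b hb)
        have : ((P j).filter fun y => ¬ Good (cl x) (Q b) {y}) ⊆
            ((P j).filter fun y => ¬ Good (Q b) (cl x) {y}) := by
          intro y hy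
          rw [Finset.mem_filter] at hy ⊢
          exact ⟨hy.1, fun h => hy.2 h.swap⟩
        exact_mod_cast Finset.card_le_card this
    · rcases Finset.mem_insert.1 hb with rfl | hb
      · rw [hut, hua a ha2]; exact key a ha2
      · rw [hua a ha2, hua b hb]; exact hQ.i2 a ha2 b hb hab j hj.2
  · intro a ha b hb c hc hab hac hbc
    have key : ∀ a ∈ T, ∀ b ∈ T, a ≠ b → Good (Q a) (Q b) (cl x) :=
      fun a ha b hb h => (hgood a b).2.2 ha hb h
    rcases Finset.mem_insert.1 ha with rfl | ha2
    · have hb := Finset.mem_of_mem_insert_of_ne hb hab.symm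
      have hc := Finset.mem_of_mem_insert_of_ne hc hac.symm
      rw [hut, hua b hb, hua c hc]
      exact (key b hb c hc hbc).rot.rot
    · rcases Finset.mem_insert.1 hb with rfl | hb2
      · have hc := Finset.mem_of_mem_insert_of_ne hc hbc.symm
        rw [hut, hua a ha2, hua c hc]
        exact (key a ha2 c hc hac).swap.rot
      · rcases Finset.mem_insert.1 hc with rfl | hc2
        · rw [hut, hua a ha2, hua b hb2]
          exact key a ha2 b hb2 hab
        · rw [hua a ha2, hua b hb2, hua c hc2]
          exact hQ.i3 a ha2 b hb2 c hc2 hab hac hbc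

theorem disjointify {k : ℕ} (P : Fin k → Finset (ℝ × ℝ)) (hP : ∀ i, (P i).Nonempty) :
    ∃ Q : Fin k → Finset (ℝ × ℝ), (∀ i, Q i ⊆ P i) ∧ (∀ i, (Q i).Nonempty) ∧
      (∀ i, (P i).card ≤ 2 * k * (Q i).card) ∧
      ∀ i j, i ≠ j → Disjoint (Q i) (Q j) ∨ ∃ p, Q i = {p} ∧ Q j = {p} := by
  classical
  have main : ∀ S : Finset (Fin k), ∃ Q : Fin k → Finset (ℝ × ℝ),
      (∀ i ∈ S, Q i ⊆ P i) ∧ (∀ i ∈ S, (Q i).card = max 1 ((P i).card / k)) ∧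
      ∀ i ∈ S, ∀ j ∈ S, i ≠ j → Disjoint (Q i) (Q j) ∨ ∃ p, Q i = {p} ∧ Q j = {p} := by
    intro S
    induction S using Finset.induction_on_max_value (fun i => (P i).card) with
    | empty => exact ⟨P, by simp, by simp, by simp⟩
    | insert a S ha hmax ih =>
      obtain ⟨Q, q1, q2, q3⟩ := ih
      have hk : 0 < k := a.pos
      obtain ⟨R, hR1, hR2, hR3⟩ : ∃ R ⊆ P a, R.card = max 1 ((P a).card / k) ∧
          ∀ i ∈ S, Disjoint (Q i) R ∨ ∃ p, Q i = {p} ∧ R = {p} := by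
        by_cases hbig : k ≤ (P a).card
        · have hm : 1 ≤ (P a).card / k := (Nat.one_le_div_iff hk).2 hbig
          have hU : (S.biUnion Q).card ≤ S.card * ((P a).card / k) := by
            apply Finset.card_biUnion_le_card_mul
            intro i hi
            rw [q2 i hi]
            exact max_le hm (Nat.div_le_div_right (hmax i hi))
          have hS : S.card + 1 ≤ k := by
            have := Finset.card_le_univ (insert a S)
            rwa [Finset.card_insert_of_notMem ha, Fintype.card_fin] at this
          have h1 : (P a).card / k * k ≤ (P a).card := Nat.div_mul_le_self _ _
          have h2 : (S.card + 1) * ((P a).card / k) ≤ k * ((P a).card / k) :=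
            Nat.mul_le_mul_right _ hS
          have h3 := Finset.le_card_sdiff (S.biUnion Q) (P a)
          have h4 : (P a).card / k ≤ (P a \ S.biUnion Q).card := by
            have : (S.card + 1) * ((P a).card / k) = S.card * ((P a).card / k) + (P a).card / k := by
              ring
            have : (P a).card / k * k = k * ((P a).card / k) := mul_comm _ _
            omega
          obtain ⟨R, hR, hRc⟩ := Finset.exists_subset_card_eq h4
          refine ⟨R, hR.trans Finset.sdiff_subset, by rw [hRc, max_eq_right hm], ?_⟩
          intro i hi
          left
          rw [Finset.disjoint_left]
          intro p hp hpR
          exact (Finset.mem_sdiff.1 (hR hpR)).2 (Finset.mem_biUnion.2 ⟨i, hi, hp⟩)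
        · push Not at hbig
          obtain ⟨p, hp⟩ := hP a
          refine ⟨{p}, by simpa using hp, by rw [Nat.div_eq_of_lt hbig]; simp, ?_⟩
          intro i hi
          have := q2 i hi
          rw [Nat.div_eq_of_lt ((hmax i hi).trans_lt hbig)] at this
          obtain ⟨r, hr⟩ := Finset.card_eq_one.1 (by simpa using this)
          by_cases hpr : r = p
          · right; exact ⟨p, by rw [hr, hpr], rfl⟩
          · left; rw [hr]; simpa using hpr
      have hua : ∀ i ∈ S, Function.update Q a R i = Q i := fun i hi =>
        Function.update_of_ne (fun h : i = a => ha (h ▸ hi)) _ _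
      have haa : Function.update Q a R a = R := Function.update_self _ _ _
      refine ⟨Function.update Q a R, ?_, ?_, ?_⟩
      · intro i hi
        rcases Finset.mem_insert.1 hi with rfl | hi2
        · rw [haa]; exact hR1
        · rw [hua i hi2]; exact q1 i hi2
      · intro i hi
        rcases Finset.mem_insert.1 hi with rfl | hi2
        · rw [haa]; exact hR2
        · rw [hua i hi2]; exact q2 i hi2
      · intro i hi j hj hij
        rcases Finset.mem_insert.1 hi with rfl | hi2
        · have hj2 := Finset.mem_of_mem_insert_of_ne hj hij.symm
          rw [haa, hua j hj2]
          rcases hR3 j hj2 with h | ⟨p, h1, h2⟩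
          · exact Or.inl h.symm
          · exact Or.inr ⟨p, h2, h1⟩
        · rcases Finset.mem_insert.1 hj with rfl | hj2
          · rw [haa, hua i hi2]; exact hR3 i hi2
          · rw [hua i hi2, hua j hj2]; exact q3 i hi2 j hj2 hij
  obtain ⟨Q, q1, q2, q3⟩ := main Finset.univ
  refine ⟨Q, fun i => q1 i (Finset.mem_univ _), fun i => Finset.card_pos.1 ?_, fun i => ?_,
    fun i j h => q3 i (Finset.mem_univ _) j (Finset.mem_univ _) h⟩
  · rw [q2 i (Finset.mem_univ _)]; exact lt_of_lt_of_le one_pos (le_max_left _ _)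
  · rw [q2 i (Finset.mem_univ _)]
    have hk : 0 < k := i.pos
    have h1 := Nat.lt_mul_div_succ (P i).card hk
    have h2 : 1 ≤ max 1 ((P i).card / k) := le_max_left _ _
    have h3 : (P i).card / k ≤ max 1 ((P i).card / k) := le_max_right _ _
    calc (P i).card ≤ k * ((P i).card / k + 1) := h1.le
      _ ≤ k * (max 1 ((P i).card / k) + max 1 ((P i).card / k)) := by gcongr
      _ = _ := by ring

theorem collinear_of_dF {u w q : ℝ × ℝ} (huw : u ≠ w) (h : dF u w q = 0) :
    Collinear ℝ ({u, w, q} : Set (ℝ × ℝ)) := by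
  rw [collinear_iff_of_mem (p₀ := u) (by simp)]
  refine ⟨w - u, ?_⟩
  have hq : ∃ r : ℝ, q = r • (w - u) + u := by
    simp only [dF] at h
    by_cases h1 : w.1 - u.1 = 0
    · have h2 : w.2 - u.2 ≠ 0 := by
        intro h2
        exact huw (Prod.ext (by linarith) (by linarith))
      refine ⟨(q.2 - u.2) / (w.2 - u.2), Prod.ext ?_ ?_⟩
      · simp only [Prod.fst_add, Prod.smul_fst, Prod.fst_sub, smul_eq_mul, h1]
        rw [h1] at h
        have : (w.2 - u.2) * (q.1 - u.1) = 0 := by linarith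
        rcases mul_eq_zero.1 this with h3 | h3
        · exact absurd h3 h2
        · linarith
      · simp only [Prod.snd_add, Prod.smul_snd, Prod.snd_sub, smul_eq_mul]
        field_simp; ring
    · refine ⟨(q.1 - u.1) / (w.1 - u.1), Prod.ext ?_ ?_⟩
      · simp only [Prod.fst_add, Prod.smul_fst, Prod.fst_sub, smul_eq_mul]
        field_simp; ring
      · simp only [Prod.snd_add, Prod.smul_snd, Prod.snd_sub, smul_eq_mul]
        field_simp
        linarith
  intro p hp
  simp only [Set.mem_insert_iff, Set.mem_singleton_iff] at hp
  rcases hp with rfl | rfl | rfl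
  · exact ⟨0, by simp⟩
  · exact ⟨1, by simp⟩
  · obtain ⟨r, hr⟩ := hq
    exact ⟨r, by simpa using hr⟩

theorem tri_of {k : ℕ} (P Q : Fin k → Finset (ℝ × ℝ)) 
    (hG : InGeneralPosition (⋃ i, (P i : Set (ℝ × ℝ)))) (hQ : ∀ i, Q i ⊆ P i)
    (hd : ∀ i j, i ≠ j → Disjoint (Q i) (Q j) ∨ ∃ p, Q i = {p} ∧ Q j = {p}) (i j l : Fin k)
    (hij : i ≠ j) (hil : i ≠ l) (hjl : j ≠ l) :
      (∀ u ∈ Q i, ∀ w ∈ Q j, ∀ q ∈ Q l, dF u w q ≠ 0) ∨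
      (∀ u ∈ Q i, ∀ w ∈ Q j, ∀ q ∈ Q l, dF u w q = 0) := by
  rcases hd i j hij with h1 | ⟨p, h1, h1'⟩
  · rcases hd i l hil with h2 | ⟨p, h2, h2'⟩
    · rcases hd j l hjl with h3 | ⟨p, h3, h3'⟩
      · left
        intro u hu w hw q hq h0
        have huw : u ≠ w := Finset.disjoint_iff_ne.1 h1 u hu w hw
        have m : ∀ i, ∀ x ∈ Q i, x ∈ (⋃ i, (P i : Set (ℝ × ℝ))) := fun i x hx =>
          Set.mem_iUnion.2 ⟨i, hQ i hx⟩
        exact hG u (m i u hu) w (m j w hw) q (m l q hq) huw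
          (Finset.disjoint_iff_ne.1 h2 u hu q hq) (Finset.disjoint_iff_ne.1 h3 w hw q hq)
          (collinear_of_dF huw h0)
      · right
        rw [h3, h3']
        intro u _ w hw q hq
        rw [Finset.mem_singleton] at hw hq
        rw [hw, hq]; simp only [dF]; ring
    · right
      rw [h2, h2']
      intro u hu w _ q hq
      rw [Finset.mem_singleton] at hu hq
      rw [hu, hq]; simp only [dF]; ring
  · right
    rw [h1, h1']
    intro u hu w hw q _
    rw [Finset.mem_singleton] at hu hw
    rw [hu, hw]; simp only [dF]; ring

theorem same_type_lemma :
    ∃ c : ℝ, 0 < c ∧ ∀ (k : ℕ), 3 ≤ k → ∀ P : Fin k → Finset (ℝ × ℝ),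
      (∀ i, (P i).Nonempty) →
      InGeneralPosition (⋃ i, (P i : Set (ℝ × ℝ))) →
      ∃ P' : Fin k → Finset (ℝ × ℝ),
        (∀ i, P' i ⊆ P i) ∧
        (∀ i, (2 : ℝ) ^ (-(c * (k : ℝ) * Real.log (k : ℝ))) * ((P i).card : ℝ)
          ≤ ((P' i).card : ℝ)) ∧
        SameTypeTransversals P' := by
  classical
  refine ⟨227, by norm_num, ?_⟩
  intro k hk P hP hG
  obtain ⟨Q, hQP, hQne, hQc, hQd⟩ := disjointify P hP
  have hTri := tri_of P Q hG hQP hQd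
  set s : ℕ := 5 * (9 + 6 * k) with hs
  have hk0 : (0 : ℝ) < k := by exact_mod_cast (by omega : 0 < k)
  set K : ℝ := (k : ℝ) ^ 2 with hK
  have hKpos : 0 < K := by positivity
  have hK1 : 1 ≤ K := by
    have : (1 : ℝ) ≤ k := by exact_mod_cast (by omega : 1 ≤ k)
    rw [hK]; nlinarith
  have hηs : (6 / 7 : ℝ) ^ s ≤ 1 / (512 * K ^ 3) := by
    have h1 : (6 / 7 : ℝ) ^ s ≤ (1 / 2) ^ (9 + 6 * k) := by
      rw [hs, pow_mul]
      gcongr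
      norm_num
    have h2 : (512 : ℝ) * K ^ 3 ≤ 2 ^ (9 + 6 * k) := by
      have h3 : (k : ℝ) ≤ 2 ^ k := by exact_mod_cast Nat.lt_two_pow_self.le
      have h4 : K ^ 3 ≤ 2 ^ (6 * k) := by
        calc K ^ 3 = (k : ℝ) ^ 6 := by rw [hK]; ring
          _ ≤ (2 ^ k) ^ 6 := by gcongr
          _ = _ := by rw [← pow_mul, mul_comm]
      rw [pow_add]; norm_num; linarith
    refine h1.trans ?_
    rw [one_div_pow]
    exact one_div_le_one_div_of_le (by positivity) h2
  have hsmall : (k : ℝ) ^ 2 * ((1 / (512 * K ^ 3)) / (1 / (64 * K ^ 2)) +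
      (6 * (1 / (512 * K ^ 3)) + 1 / (64 * K ^ 2)) / (1 / (8 * K)) +
      (6 * (1 / (512 * K ^ 3)) + 1 / (8 * K))) < 1 := by
    rw [← hK]
    have e : K * ((1 / (512 * K ^ 3)) / (1 / (64 * K ^ 2)) +
      (6 * (1 / (512 * K ^ 3)) + 1 / (64 * K ^ 2)) / (1 / (8 * K)) +
      (6 * (1 / (512 * K ^ 3)) + 1 / (8 * K))) =
      1 / 8 + 48 / 512 * (1 / K) + 1 / 8 + 6 / 512 * (1 / K) ^ 2 + 1 / 8 := by
      field_simp; ring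
    rw [e]
    have h1 : 1 / K ≤ 1 := by rw [div_le_one hKpos]; exact hK1
    have h0 : 0 ≤ 1 / K := by positivity
    nlinarith
  have hall : ∀ T : Finset (Fin k), ∃ R, TInv Q s (1 / (64 * K ^ 2)) (1 / (8 * K)) T R := by
    intro T
    induction T using Finset.induction_on with
    | empty => exact ⟨Q, by simp, by simp, by simp, by simp, by simp, by simp⟩
    | insert t T ht ih =>
      obtain ⟨R, hR⟩ := ih
      exact step Q hQne hTri s _ _ _ (by positivity) (by positivity) (by positivity) hηs hsmall
        T t ht R hR
  obtain ⟨R, hR⟩ := hall Finset.univ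
  refine ⟨R, fun i => (hR.sub i (Finset.mem_univ _)).trans (hQP i), fun i => ?_, ?_⟩
  · have h1 := hR.card i (Finset.mem_univ _)
    have h2 : (P i).card ≤ 2 * k * (7 ^ s * (R i).card) := (hQc i).trans (by gcongr)
    have h3 : ((P i).card : ℝ) ≤ 2 * k * (7 ^ s * (R i).card) := by exact_mod_cast h2
    have hlog : 1 ≤ Real.log k := by
      rw [Real.le_log_iff_exp_le hk0]
      have : (3 : ℝ) ≤ k := by exact_mod_cast hk
      linarith [Real.exp_one_lt_d9]
    have h4 : (2 : ℝ) * k * 7 ^ s ≤ 2 ^ (227 * k) := by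
      have a1 : (k : ℝ) ≤ 2 ^ k := by exact_mod_cast Nat.lt_two_pow_self.le
      have a2 : (7 : ℝ) ^ s ≤ 2 ^ (3 * s) := by
        rw [pow_mul (2 : ℝ) 3 s]; exact pow_le_pow_left₀ (by norm_num) (by norm_num) s
      calc (2 : ℝ) * k * 7 ^ s ≤ 2 * 2 ^ k * 2 ^ (3 * s) := by gcongr
        _ = 2 ^ (1 + k + 3 * s) := by rw [pow_add, pow_add, pow_one]
        _ ≤ 2 ^ (227 * k) := by
          apply pow_le_pow_right₀ (by norm_num)
          omega
    have h5 : (2 : ℝ) ^ (227 * k) ≤ (2 : ℝ) ^ (227 * (k : ℝ) * Real.log k) := by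
      rw [← Real.rpow_natCast]
      apply Real.rpow_le_rpow_of_exponent_le (by norm_num)
      push_cast
      nlinarith
    have hpos : (0 : ℝ) < (2 : ℝ) ^ (227 * (k : ℝ) * Real.log k) := by positivity
    rw [Real.rpow_neg (by norm_num), inv_mul_le_iff₀ hpos]
    calc ((P i).card : ℝ) ≤ 2 * k * 7 ^ s * (R i).card := by linarith
      _ ≤ _ := mul_le_mul_of_nonneg_right (h4.trans h5) (Nat.cast_nonneg _)
  · intro f g hf hg i j l hij hjl
    have hil := hij.trans hjl
    have ho : ∀ p q r, orient p q r = Real.sign (dF p q r) := fun _ _ _ => rfl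
    rw [ho, ho]
    have sb : ∀ i, R i ⊆ Q i := fun i => hR.sub i (Finset.mem_univ _)
    rcases hTri i j l hij.ne hil.ne hjl.ne with h | h
    · have nf := h _ (sb i (hf i)) _ (sb j (hf j)) _ (sb l (hf l))
      have ng := h _ (sb i (hg i)) _ (sb j (hg j)) _ (sb l (hg l))
      rcases hR.i3 i (Finset.mem_univ _) j (Finset.mem_univ _) l (Finset.mem_univ _)
        hij.ne hil.ne hjl.ne with h2 | h2
      · have pf := lt_of_le_of_ne (h2 _ (hf i) _ (hf j) _ (hf l)) nf.symm
        have pg := lt_of_le_of_ne (h2 _ (hg i) _ (hg j) _ (hg l)) ng.symm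
        rw [Real.sign_of_pos pf, Real.sign_of_pos pg]
      · have pf := lt_of_le_of_ne (h2 _ (hf i) _ (hf j) _ (hf l)) nf
        have pg := lt_of_le_of_ne (h2 _ (hg i) _ (hg j) _ (hg l)) ng
        rw [Real.sign_of_neg pf, Real.sign_of_neg pg]
    · rw [h _ (sb i (hf i)) _ (sb j (hf j)) _ (sb l (hf l)),
        h _ (sb i (hg i)) _ (sb j (hg j)) _ (sb l (hg l))]
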